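/- Let M̄ = M₁ ×_f M₂ be a twisted product with ξ = log f, dim M₂ = n. Then for vectors tangent to the fiber, Ric̄(∂_α,∂_β) = Ric^{M₂}(∂_α,∂_β) + (2−n)(∂_α(ξ)∂_β(ξ) + H_ξ(∂_α,∂_β)) + (n−2) ḡ(∂_α,∂_β) ḡ(∇ξ,∇ξ) − ḡ(∂_α,∂_β) Δξ, where ∇, Δ, H are taken with respect to ḡ. -/

import Mathlib

noncomputable section

open Matrix

variable {ι : Type*} [Fintype ι] [DecidableEq ι]

/-- Partial derivative in the `i`-th coordinate direction. -/
def pd (i : ι) (φ : (ι → ℝ) → ℝ) (x : ι → ℝ) : ℝ :=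
  fderiv ℝ φ x (Pi.single i 1)

/-- Christoffel symbols `Γ^k_{ij}` of a coordinate metric. -/
def christoffel (g : (ι → ℝ) → Matrix ι ι ℝ) (k i j : ι) (x : ι → ℝ) : ℝ :=
  (1 / 2) * ∑ l, (g x)⁻¹ k l *
    (pd i (fun y => g y l j) x + pd j (fun y => g y l i) x - pd l (fun y => g y i j) x)

/-- Ricci curvature components `R_{ij}` of a coordinate metric. -/
def ricci (g : (ι → ℝ) → Matrix ι ι ℝ) (i j : ι) (x : ι → ℝ) : ℝ :=
  (∑ k, (pd k (christoffel g k i j) x - pd j (christoffel g k i k) x))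
  + ∑ k, ∑ l, (christoffel g k k l x * christoffel g l i j x
      - christoffel g k j l x * christoffel g l i k x)

/-- Scalar curvature of a coordinate metric. -/
def scalarCurv (g : (ι → ℝ) → Matrix ι ι ℝ) (x : ι → ℝ) : ℝ :=
  ∑ i, ∑ j, (g x)⁻¹ i j * ricci g i j x

/-- Hessian `H_φ(∂_i,∂_j)` with respect to the Levi-Civita connection of `g`. -/
def hess (g : (ι → ℝ) → Matrix ι ι ℝ) (φ : (ι → ℝ) → ℝ) (i j : ι) (x : ι → ℝ) : ℝ :=
  pd i (pd j φ) x - ∑ k, christoffel g k i j x * pd k φ x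

/-- Laplace–Beltrami operator of `g`. -/
def laplacian (g : (ι → ℝ) → Matrix ι ι ℝ) (φ : (ι → ℝ) → ℝ) (x : ι → ℝ) : ℝ :=
  ∑ i, ∑ j, (g x)⁻¹ i j * hess g φ i j x

/-- Inner product of gradients `g(∇φ,∇ψ)`. -/
def gradInner (g : (ι → ℝ) → Matrix ι ι ℝ) (φ ψ : (ι → ℝ) → ℝ) (x : ι → ℝ) : ℝ :=
  ∑ i, ∑ j, (g x)⁻¹ i j * pd i φ x * pd j ψ x

/-- Einstein tensor `G_{ij} = R_{ij} - (1/2) S g_{ij}`. -/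
def einstein (g : (ι → ℝ) → Matrix ι ι ℝ) (i j : ι) (x : ι → ℝ) : ℝ :=
  ricci g i j x - (1 / 2) * scalarCurv g x * g x i j

/-- A (pseudo-Riemannian) coordinate metric: symmetric, everywhere invertible and smooth. -/
def IsMetric (g : (ι → ℝ) → Matrix ι ι ℝ) : Prop :=
  (∀ x, (g x).IsSymm) ∧ (∀ x, IsUnit (g x).det) ∧
    ∀ i j, ContDiff ℝ (⊤ : ℕ∞) (fun x => g x i j)

/-- A Riemannian coordinate metric. -/
def IsRiemannMetric (g : (ι → ℝ) → Matrix ι ι ℝ) : Prop :=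
  (∀ x, (g x).PosDef) ∧ ∀ i j, ContDiff ℝ (⊤ : ℕ∞) (fun x => g x i j)

/-- The twisted product metric `ḡ = g ⊕ f²h` on `M₁ × M₂`, where the twisting
function `f` may depend on the points of both factors. -/
def twistedMetric {m n : ℕ} (g : (Fin m → ℝ) → Matrix (Fin m) (Fin m) ℝ)
    (h : (Fin n → ℝ) → Matrix (Fin n) (Fin n) ℝ)
    (f : ((Fin m ⊕ Fin n) → ℝ) → ℝ) :
    ((Fin m ⊕ Fin n) → ℝ) → Matrix (Fin m ⊕ Fin n) (Fin m ⊕ Fin n) ℝ :=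
  fun x => Matrix.fromBlocks (g (x ∘ Sum.inl)) 0 0 ((f x) ^ 2 • h (x ∘ Sum.inr))

open scoped ContDiff

section Calculus

variable {φ ψ : (ι → ℝ) → ℝ} {x : ι → ℝ}

theorem pd_add (i : ι) (hφ : DifferentiableAt ℝ φ x) (hψ : DifferentiableAt ℝ ψ x) :
    pd i (fun y => φ y + ψ y) x = pd i φ x + pd i ψ x := by
  simp [pd, fderiv_fun_add hφ hψ]

theorem pd_sub (i : ι) (hφ : DifferentiableAt ℝ φ x) (hψ : DifferentiableAt ℝ ψ x) :
    pd i (fun y => φ y - ψ y) x = pd i φ x - pd i ψ x := by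
  simp [pd, fderiv_fun_sub hφ hψ]

theorem pd_neg (i : ι) : pd i (fun y => -φ y) x = -pd i φ x := by
  simp [pd, fderiv_fun_neg]

theorem pd_mul (i : ι) (hφ : DifferentiableAt ℝ φ x) (hψ : DifferentiableAt ℝ ψ x) :
    pd i (fun y => φ y * ψ y) x = pd i φ x * ψ x + φ x * pd i ψ x := by
  simp [pd, fderiv_fun_mul hφ hψ]
  ring

@[simp]
theorem pd_const {κ : Type*} [DecidableEq κ] (i : κ) (c : ℝ) (x : κ → ℝ) :
    pd i (fun _ => c) x = 0 := by
  simp [pd]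

theorem pd_sum {κ : Type*} (s : Finset κ) (i : ι) {Φ : κ → (ι → ℝ) → ℝ}
    (hΦ : ∀ k ∈ s, DifferentiableAt ℝ (Φ k) x) :
    pd i (fun y => ∑ k ∈ s, Φ k y) x = ∑ k ∈ s, pd i (Φ k) x := by
  simp [pd, fderiv_fun_sum hΦ]

theorem contDiff_pd (i : ι) (hφ : ContDiff ℝ ∞ φ) : ContDiff ℝ ∞ (pd i φ) :=
  (hφ.fderiv_right (m := ∞) (by simp)).clm_apply contDiff_const

theorem pd_comm (i j : ι) (hφ : ContDiff ℝ ∞ φ) (x : ι → ℝ) :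
    pd i (pd j φ) x = pd j (pd i φ) x := by
  have hd : DifferentiableAt ℝ (fderiv ℝ φ) x :=
    (hφ.fderiv_right (m := ∞) (by simp)).differentiable (by simp) x
  have key (a b : ι) : pd a (pd b φ) x
      = fderiv ℝ (fderiv ℝ φ) x (Pi.single a 1) (Pi.single b 1) := by
    change fderiv ℝ (fun y => fderiv ℝ φ y (Pi.single b 1)) x (Pi.single a 1) = _
    rw [fderiv_clm_apply hd (differentiableAt_const _)]
    simp
  rw [key, key]
  exact ((contDiff_infty.1 hφ 2).contDiffAt.isSymmSndFDerivAt (by simp)) _ _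

end Calculus

section Restriction

variable {κ μ : Type*} [Fintype κ] [Fintype μ]

theorem contDiff_comp_right (s : κ → μ) {φ : (κ → ℝ) → ℝ} (hφ : ContDiff ℝ ∞ φ) :
    ContDiff ℝ ∞ (fun y : μ → ℝ => φ (y ∘ s)) :=
  hφ.comp (contDiff_pi.2 fun i => contDiff_apply ℝ ℝ (s i))

theorem pd_comp_right [DecidableEq μ] (s : κ → μ) {φ : (κ → ℝ) → ℝ} (hφ : ContDiff ℝ ∞ φ) (i : μ)
    (x : μ → ℝ) :
    pd i (fun y => φ (y ∘ s)) x
      = fderiv ℝ φ (x ∘ s) ((Pi.single i 1 : μ → ℝ) ∘ s) := by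
  let L : (μ → ℝ) →L[ℝ] (κ → ℝ) := ContinuousLinearMap.pi fun k => ContinuousLinearMap.proj (s k)
  have h1 : fderiv ℝ (φ ∘ L) x = (fderiv ℝ φ (L x)).comp L := by
    rw [fderiv_comp x (hφ.differentiable (by simp) _) L.differentiableAt, L.fderiv]
  exact congrArg (fun T : (μ → ℝ) →L[ℝ] ℝ => T (Pi.single i 1)) h1

variable [DecidableEq κ] [DecidableEq μ]

@[simp]
theorem pd_inl_comp_inl {φ : (κ → ℝ) → ℝ} (hφ : ContDiff ℝ ∞ φ) (i : κ) (x : κ ⊕ μ → ℝ) :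
    pd (Sum.inl i) (fun y => φ (y ∘ Sum.inl)) x = pd i φ (x ∘ Sum.inl) := by
  rw [pd_comp_right _ hφ, pd]
  congr 1
  ext k
  simp [Pi.single_apply]

@[simp]
theorem pd_inr_comp_inr {φ : (μ → ℝ) → ℝ} (hφ : ContDiff ℝ ∞ φ) (i : μ) (x : κ ⊕ μ → ℝ) :
    pd (Sum.inr i) (fun y => φ (y ∘ Sum.inr)) x = pd i φ (x ∘ Sum.inr) := by
  rw [pd_comp_right _ hφ, pd]
  congr 1
  ext k
  simp [Pi.single_apply]

@[simp]
theorem pd_inl_comp_inr {φ : (μ → ℝ) → ℝ} (hφ : ContDiff ℝ ∞ φ) (i : κ) (x : κ ⊕ μ → ℝ) :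
    pd (Sum.inl i) (fun y => φ (y ∘ Sum.inr)) x = 0 := by
  rw [pd_comp_right _ hφ]
  have : (Pi.single (Sum.inl i) 1 : κ ⊕ μ → ℝ) ∘ Sum.inr = 0 := by ext k; simp
  simp [this]

@[simp]
theorem pd_inr_comp_inl {φ : (κ → ℝ) → ℝ} (hφ : ContDiff ℝ ∞ φ) (i : μ) (x : κ ⊕ μ → ℝ) :
    pd (Sum.inr i) (fun y => φ (y ∘ Sum.inl)) x = 0 := by
  rw [pd_comp_right _ hφ]
  have : (Pi.single (Sum.inr i) 1 : κ ⊕ μ → ℝ) ∘ Sum.inl = 0 := by ext k; simp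
  simp [this]

end Restriction

section Metric

theorem contDiff_det {E : Type*} [NormedAddCommGroup E] [NormedSpace ℝ E]
    {g : E → Matrix ι ι ℝ} (hg : ∀ i j, ContDiff ℝ ∞ (fun x => g x i j)) :
    ContDiff ℝ ∞ (fun x => (g x).det) := by
  simp only [Matrix.det_apply]
  exact ContDiff.sum fun σ _ => (contDiff_prod fun i _ => hg _ _).const_smul _

variable {g : (ι → ℝ) → Matrix ι ι ℝ}

theorem IsMetric.contDiff_inv (hg : IsMetric g) (i j : ι) :
    ContDiff ℝ ∞ (fun x => (g x)⁻¹ i j) := by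
  simp only [Matrix.inv_def, Ring.inverse_eq_inv', Matrix.smul_apply, smul_eq_mul,
    Matrix.adjugate_apply]
  refine ((contDiff_det hg.2.2).inv fun x => (hg.2.1 x).ne_zero).mul (contDiff_det fun a b => ?_)
  by_cases hab : a = j
  · simp only [Matrix.updateRow_apply, hab, if_true]
    exact contDiff_const
  · simpa only [Matrix.updateRow_apply, hab, if_false] using hg.2.2 a b

theorem IsMetric.contDiff_christoffel (hg : IsMetric g) (k i j : ι) :
    ContDiff ℝ ∞ (christoffel g k i j) := by
  refine contDiff_const.mul (ContDiff.sum fun l _ => (hg.contDiff_inv k l).mul ?_)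
  exact ((contDiff_pd i (hg.2.2 l j)).add (contDiff_pd j (hg.2.2 l i))).sub
    (contDiff_pd l (hg.2.2 i j))

theorem IsMetric.symm_apply (hg : IsMetric g) (x : ι → ℝ) (i j : ι) : g x i j = g x j i :=
  (hg.1 x).apply j i

theorem IsMetric.christoffel_symm (hg : IsMetric g) (k i j : ι) (x : ι → ℝ) :
    christoffel g k i j x = christoffel g k j i x := by
  have : (fun y => g y i j) = fun y => g y j i := funext fun y => hg.symm_apply y i j
  have h2 (l : ι) : pd l (fun y => g y i j) x = pd l (fun y => g y j i) x := by rw [this]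
  simp only [christoffel, h2]
  congr 1
  exact Finset.sum_congr rfl fun l _ => by ring

theorem IsMetric.sum_mul_inv (hg : IsMetric g) (x : ι → ℝ) (i j : ι) :
    ∑ l, g x i l * (g x)⁻¹ l j = if i = j then 1 else 0 := by
  rw [← Matrix.mul_apply, Matrix.mul_nonsing_inv _ (hg.2.1 x), Matrix.one_apply]

theorem IsMetric.sum_inv_mul (hg : IsMetric g) (x : ι → ℝ) (i j : ι) :
    ∑ l, (g x)⁻¹ i l * g x l j = if i = j then 1 else 0 := by
  rw [← Matrix.mul_apply, Matrix.nonsing_inv_mul _ (hg.2.1 x), Matrix.one_apply]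

theorem IsMetric.sum_mul_inv_mul (hg : IsMetric g) (x : ι → ℝ) (i : ι) (w : ι → ℝ) :
    ∑ l, g x i l * ∑ j, (g x)⁻¹ l j * w j = w i := by
  have := congrFun (show g x *ᵥ ((g x)⁻¹ *ᵥ w) = w by
    rw [Matrix.mulVec_mulVec, Matrix.mul_nonsing_inv _ (hg.2.1 x), Matrix.one_mulVec]) i
  exact this

theorem IsMetric.sum_mul_christoffel (hg : IsMetric g) (p i j : ι) (x : ι → ℝ) :
    ∑ l, g x p l * christoffel g l i j x = (1 / 2) *
      (pd i (fun y => g y p j) x + pd j (fun y => g y p i) x - pd p (fun y => g y i j) x) := by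
  rw [← hg.sum_mul_inv_mul x p fun p => (1 / 2) *
      (pd i (fun y => g y p j) x + pd j (fun y => g y p i) x - pd p (fun y => g y i j) x)]
  refine Finset.sum_congr rfl fun l _ => ?_
  rw [christoffel, Finset.mul_sum]
  congr 1
  exact Finset.sum_congr rfl fun l _ => by ring

/-- Metric compatibility of the Levi-Civita connection. -/
theorem IsMetric.pd_apply (hg : IsMetric g) (k i j : ι) (x : ι → ℝ) :
    pd k (fun y => g y i j) x
      = ∑ l, (g x i l * christoffel g l k j x + g x j l * christoffel g l k i x) := by
  have hs (a b c : ι) : pd a (fun y => g y b c) x = pd a (fun y => g y c b) x := by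
    rw [show (fun y => g y b c) = fun y => g y c b from funext fun y => hg.symm_apply y b c]
  rw [Finset.sum_add_distrib, hg.sum_mul_christoffel, hg.sum_mul_christoffel, hs j k i, hs i j k,
    hs k j i, hs j i k, hs i k j]
  ring

theorem IsMetric.pd_inv_apply (hg : IsMetric g) (k i j : ι) (x : ι → ℝ) :
    pd k (fun y => (g y)⁻¹ i j) x
      = -∑ l, (christoffel g i k l x * (g x)⁻¹ l j + (g x)⁻¹ i l * christoffel g j k l x) := by
  let A := g x
  let B := (g x)⁻¹
  let C : Matrix ι ι ℝ := Matrix.of fun l j => christoffel g l k j x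
  let A' : Matrix ι ι ℝ := Matrix.of fun i j => pd k (fun y => g y i j) x
  let B' : Matrix ι ι ℝ := Matrix.of fun i j => pd k (fun y => (g y)⁻¹ i j) x
  have hAB : A * B = 1 := Matrix.mul_nonsing_inv _ (hg.2.1 x)
  have hBA : B * A = 1 := Matrix.nonsing_inv_mul _ (hg.2.1 x)
  have hA' : A' = A * C + Cᵀ * A := by
    ext a b
    simp only [A', Matrix.of_apply, hg.pd_apply, Finset.sum_add_distrib, Matrix.add_apply,
      Matrix.mul_apply, Matrix.transpose_apply, C, A]
    congr 1
    exact Finset.sum_congr rfl fun l _ => by rw [hg.symm_apply x b l, mul_comm]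
  have hd (a b : ι) : DifferentiableAt ℝ (fun y => g y a b) x :=
    (hg.2.2 a b).differentiable (by simp) x
  have hd' (a b : ι) : DifferentiableAt ℝ (fun y => (g y)⁻¹ a b) x :=
    (hg.contDiff_inv a b).differentiable (by simp) x
  have h0 : A' * B + A * B' = 0 := by
    ext a b
    have h1 : pd k (fun y => ∑ l, g y a l * (g y)⁻¹ l b) x = 0 := by
      simp only [hg.sum_mul_inv, pd_const]
    rw [pd_sum _ _ fun l _ => (hd a l).fun_mul (hd' l b)] at h1
    simp only [pd_mul k (hd _ _) (hd' _ _), Finset.sum_add_distrib] at h1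
    exact h1
  have hB' : B' = -(C * B + B * Cᵀ) := by
    have h2 : B' = -(B * (A' * B)) := by
      rw [eq_neg_of_add_eq_zero_left h0, Matrix.mul_neg, neg_neg, ← Matrix.mul_assoc, hBA,
        Matrix.one_mul]
    rw [h2, hA', Matrix.add_mul, Matrix.mul_add, Matrix.mul_assoc Cᵀ, hAB, Matrix.mul_one,
      Matrix.mul_assoc A, ← Matrix.mul_assoc B, hBA, Matrix.one_mul]
  have := congrFun (congrFun hB' i) j
  simpa only [B', C, B, Matrix.of_apply, Matrix.neg_apply, Matrix.add_apply, Matrix.mul_apply,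
    Matrix.transpose_apply, ← Finset.sum_add_distrib] using this

/-- The divergence of a vector field, computed from the underlying covector field `w` with
partial derivatives `dw`. -/
theorem IsMetric.divergence_eq (hg : IsMetric g) (x : ι → ℝ) (w : ι → ℝ) (dw : ι → ι → ℝ) :
    (∑ i, ∑ j, (pd i (fun y => (g y)⁻¹ i j) x * w j + (g x)⁻¹ i j * dw i j))
        + ∑ i, (∑ k, christoffel g k k i x) * ∑ j, (g x)⁻¹ i j * w j
      = ∑ i, ∑ j, (g x)⁻¹ i j * (dw i j - ∑ k, christoffel g k i j x * w k) := by
  have h1 : ∑ i, (∑ k, christoffel g k k i x) * ∑ j, (g x)⁻¹ i j * w j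
      = ∑ i, ∑ j, ∑ l, christoffel g i i l x * (g x)⁻¹ l j * w j := by
    simp only [Finset.sum_mul, Finset.mul_sum]
    refine Finset.sum_comm.trans ((Finset.sum_congr rfl fun _ _ => Finset.sum_comm).trans
      (Finset.sum_comm.trans ?_))
    simp only [mul_assoc]
  have h2 : ∑ i, ∑ j, (g x)⁻¹ i j * ∑ k, christoffel g k i j x * w k
      = ∑ i, ∑ j, ∑ l, (g x)⁻¹ i l * christoffel g j i l x * w j := by
    simp only [Finset.mul_sum]
    conv_lhs => enter [2, i]; rw [Finset.sum_comm]
    simp only [mul_assoc]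
  rw [h1]
  simp only [hg.pd_inv_apply, mul_sub, Finset.sum_sub_distrib, Finset.sum_add_distrib, h2,
    neg_mul, Finset.sum_neg_distrib, add_mul, Finset.sum_mul]
  ring

end Metric

section Twisted

variable {m n : ℕ} {g : (Fin m → ℝ) → Matrix (Fin m) (Fin m) ℝ}
  {h : (Fin n → ℝ) → Matrix (Fin n) (Fin n) ℝ} {f : ((Fin m ⊕ Fin n) → ℝ) → ℝ}

theorem IsMetric.twistedMetric (hg : IsMetric g) (hh : IsMetric h)
    (hf : ContDiff ℝ ∞ f) (hfpos : ∀ x, 0 < f x) : IsMetric (twistedMetric g h f) := by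
  refine ⟨fun x => ?_, fun x => ?_, ?_⟩
  · exact Matrix.IsSymm.fromBlocks (hg.1 _) (by simp) ((hh.1 _).smul _)
  · rw [_root_.twistedMetric, Matrix.det_fromBlocks_zero₂₁, Matrix.det_smul]
    exact (hg.2.1 _).mul (((pow_pos (pow_pos (hfpos x) 2) _).ne'.isUnit).mul (hh.2.1 _))
  · rintro (a | α) (b | β)
    · exact contDiff_comp_right Sum.inl (hg.2.2 a b)
    · exact contDiff_const
    · exact contDiff_const
    · exact (hf.pow 2).mul (contDiff_comp_right Sum.inr (hh.2.2 α β))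

theorem inv_twistedMetric (hg : IsMetric g) (hh : IsMetric h) (hfpos : ∀ x, 0 < f x)
    (x : (Fin m ⊕ Fin n) → ℝ) :
    (twistedMetric g h f x)⁻¹
      = Matrix.fromBlocks (g (x ∘ Sum.inl))⁻¹ 0 0 ((f x ^ 2)⁻¹ • (h (x ∘ Sum.inr))⁻¹) := by
  refine Matrix.inv_eq_right_inv ?_
  rw [twistedMetric, Matrix.fromBlocks_multiply]
  simp [Matrix.mul_nonsing_inv _ (hg.2.1 _), Matrix.mul_nonsing_inv _ (hh.2.1 _), smul_smul,
    (hfpos x).ne']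

theorem pd_sq_eq_log {ι : Type*} [Fintype ι] [DecidableEq ι] {f : (ι → ℝ) → ℝ}
    (hf : ContDiff ℝ ∞ f) (hfpos : ∀ x, 0 < f x) (i : ι) (x : ι → ℝ) :
    pd i (fun y => f y ^ 2) x = 2 * f x ^ 2 * pd i (fun z => Real.log (f z)) x := by
  have hd : DifferentiableAt ℝ f x := hf.differentiable (by simp) x
  have hne := (hfpos x).ne'
  simp only [pd, fderiv.log hd hne, fderiv_fun_pow 2 hd]
  simp
  field_simp

theorem pd_twistedMetric_inr_inr (hh : IsMetric h)
    (hf : ContDiff ℝ ∞ f) (hfpos : ∀ x, 0 < f x) (x : (Fin m ⊕ Fin n) → ℝ)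
    (i : Fin m ⊕ Fin n) (α β : Fin n) :
    pd i (fun y => twistedMetric g h f y (Sum.inr α) (Sum.inr β)) x
      = f x ^ 2 * (2 * pd i (fun z => Real.log (f z)) x * h (x ∘ Sum.inr) α β
        + pd i (fun y => h (y ∘ Sum.inr) α β) x) := by
  have h1 : (fun y => twistedMetric g h f y (Sum.inr α) (Sum.inr β))
      = fun y => f y ^ 2 * h (y ∘ Sum.inr) α β := rfl
  rw [h1, pd_mul i ((hf.pow 2).differentiable (by simp) x)
    ((contDiff_comp_right Sum.inr (hh.2.2 α β)).differentiable (by simp) x),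
    pd_sq_eq_log hf hfpos]
  ring

theorem pd_twistedMetric_inl_inl (x : (Fin m ⊕ Fin n) → ℝ) (i : Fin m ⊕ Fin n) (a b : Fin m) :
    pd i (fun y => twistedMetric g h f y (Sum.inl a) (Sum.inl b)) x
      = pd i (fun y => g (y ∘ Sum.inl) a b) x := rfl

@[simp]
theorem pd_twistedMetric_inl_inr (x : (Fin m ⊕ Fin n) → ℝ)
    (i : Fin m ⊕ Fin n) (a : Fin m) (β : Fin n) :
    pd i (fun y => twistedMetric g h f y (Sum.inl a) (Sum.inr β)) x = 0 :=
  pd_const i 0 x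

@[simp]
theorem pd_twistedMetric_inr_inl (x : (Fin m ⊕ Fin n) → ℝ)
    (i : Fin m ⊕ Fin n) (α : Fin n) (b : Fin m) :
    pd i (fun y => twistedMetric g h f y (Sum.inr α) (Sum.inl b)) x = 0 :=
  pd_const i 0 x


theorem christoffel_inl_inl_inl (hg : IsMetric g) (hh : IsMetric h) (hfpos : ∀ x, 0 < f x)
    (x : (Fin m ⊕ Fin n) → ℝ) (a b c : Fin m) :
    christoffel (twistedMetric g h f) (Sum.inl a) (Sum.inl b) (Sum.inl c) x
      = christoffel g a b c (x ∘ Sum.inl) := by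
  simp [christoffel, inv_twistedMetric hg hh hfpos, pd_twistedMetric_inl_inl,
    pd_inl_comp_inl (hg.2.2 _ _)]

theorem christoffel_inr_inl_inl (hg : IsMetric g) (hh : IsMetric h) (hfpos : ∀ x, 0 < f x)
    (x : (Fin m ⊕ Fin n) → ℝ) (α : Fin n) (b c : Fin m) :
    christoffel (twistedMetric g h f) (Sum.inr α) (Sum.inl b) (Sum.inl c) x = 0 := by
  simp [christoffel, inv_twistedMetric hg hh hfpos, pd_twistedMetric_inl_inl,
    pd_inr_comp_inl (hg.2.2 _ _)]

theorem christoffel_inl_inl_inr (hg : IsMetric g) (hh : IsMetric h) (hfpos : ∀ x, 0 < f x)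
    (x : (Fin m ⊕ Fin n) → ℝ) (a b : Fin m) (γ : Fin n) :
    christoffel (twistedMetric g h f) (Sum.inl a) (Sum.inl b) (Sum.inr γ) x = 0 := by
  simp [christoffel, inv_twistedMetric hg hh hfpos, pd_twistedMetric_inl_inl,
    pd_inr_comp_inl (hg.2.2 _ _)]

theorem christoffel_inl_inr_inl (hg : IsMetric g) (hh : IsMetric h) (hfpos : ∀ x, 0 < f x)
    (x : (Fin m ⊕ Fin n) → ℝ) (a b : Fin m) (γ : Fin n) :
    christoffel (twistedMetric g h f) (Sum.inl a) (Sum.inr γ) (Sum.inl b) x = 0 := by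
  simp [christoffel, inv_twistedMetric hg hh hfpos, pd_twistedMetric_inl_inl,
    pd_inr_comp_inl (hg.2.2 _ _)]


theorem christoffel_inr_inl_inr (hg : IsMetric g) (hh : IsMetric h)
    (hf : ContDiff ℝ ∞ f) (hfpos : ∀ x, 0 < f x) (x : (Fin m ⊕ Fin n) → ℝ) (α β : Fin n) (a : Fin m) :
    christoffel (twistedMetric g h f) (Sum.inr α) (Sum.inl a) (Sum.inr β) x
      = if α = β then pd (Sum.inl a) (fun z => Real.log (f z)) x else 0 := by
  have hF : f x ≠ 0 := (hfpos x).ne'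
  simp only [christoffel, Fintype.sum_sum_type, inv_twistedMetric hg hh hfpos,
    Matrix.fromBlocks_apply₂₁, Matrix.fromBlocks_apply₂₂, Matrix.zero_apply, zero_mul,
    Finset.sum_const_zero, zero_add, Matrix.smul_apply, smul_eq_mul, pd_twistedMetric_inl_inr,
    pd_twistedMetric_inr_inl, pd_twistedMetric_inr_inr hh hf hfpos,
    pd_inl_comp_inr (hh.2.2 _ _), add_zero, sub_zero]
  have := congrArg (pd (Sum.inl a) (fun z => Real.log (f z)) x * ·)
    (hh.sum_inv_mul (x ∘ Sum.inr) α β)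
  simp only [mul_ite, mul_one, mul_zero] at this
  rw [← this, Finset.mul_sum, Finset.mul_sum]
  refine Finset.sum_congr rfl fun δ _ => ?_
  field_simp

theorem christoffel_inr_inr_inl (hg : IsMetric g) (hh : IsMetric h)
    (hf : ContDiff ℝ ∞ f) (hfpos : ∀ x, 0 < f x) (x : (Fin m ⊕ Fin n) → ℝ) (α β : Fin n) (a : Fin m) :
    christoffel (twistedMetric g h f) (Sum.inr α) (Sum.inr β) (Sum.inl a) x
      = if α = β then pd (Sum.inl a) (fun z => Real.log (f z)) x else 0 := by
  rw [(hg.twistedMetric hh hf hfpos).christoffel_symm,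
    christoffel_inr_inl_inr hg hh hf hfpos]

theorem christoffel_inl_inr_inr (hg : IsMetric g) (hh : IsMetric h)
    (hf : ContDiff ℝ ∞ f) (hfpos : ∀ x, 0 < f x) (x : (Fin m ⊕ Fin n) → ℝ) (a : Fin m) (α β : Fin n) :
    christoffel (twistedMetric g h f) (Sum.inl a) (Sum.inr α) (Sum.inr β) x
      = -(f x ^ 2 * h (x ∘ Sum.inr) α β * ∑ b, (g (x ∘ Sum.inl))⁻¹ a b *
          pd (Sum.inl b) (fun z => Real.log (f z)) x) := by
  simp only [christoffel, Fintype.sum_sum_type, inv_twistedMetric hg hh hfpos,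
    Matrix.fromBlocks_apply₁₁, Matrix.fromBlocks_apply₁₂, Matrix.zero_apply, zero_mul,
    Finset.sum_const_zero, pd_twistedMetric_inl_inr, pd_twistedMetric_inr_inr hh hf hfpos,
    pd_inl_comp_inr (hh.2.2 _ _), add_zero, zero_sub]
  rw [Finset.mul_sum, Finset.mul_sum, ← Finset.sum_neg_distrib]
  refine Finset.sum_congr rfl fun b _ => ?_
  ring

theorem christoffel_inr_inr_inr (hg : IsMetric g) (hh : IsMetric h)
    (hf : ContDiff ℝ ∞ f) (hfpos : ∀ x, 0 < f x) (x : (Fin m ⊕ Fin n) → ℝ) (α β γ : Fin n) :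
    christoffel (twistedMetric g h f) (Sum.inr α) (Sum.inr β) (Sum.inr γ) x
      = christoffel h α β γ (x ∘ Sum.inr)
        + (if α = γ then pd (Sum.inr β) (fun z => Real.log (f z)) x else 0)
        + (if α = β then pd (Sum.inr γ) (fun z => Real.log (f z)) x else 0)
        - h (x ∘ Sum.inr) β γ * ∑ δ, (h (x ∘ Sum.inr))⁻¹ α δ *
          pd (Sum.inr δ) (fun z => Real.log (f z)) x := by
  have hF : f x ≠ 0 := (hfpos x).ne'
  have h1 := congrArg (pd (Sum.inr β) (fun z => Real.log (f z)) x * ·)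
    (hh.sum_inv_mul (x ∘ Sum.inr) α γ)
  have h2 := congrArg (pd (Sum.inr γ) (fun z => Real.log (f z)) x * ·)
    (hh.sum_inv_mul (x ∘ Sum.inr) α β)
  simp only [mul_ite, mul_one, mul_zero] at h1 h2
  simp only [christoffel, Fintype.sum_sum_type, inv_twistedMetric hg hh hfpos,
    Matrix.fromBlocks_apply₂₁, Matrix.fromBlocks_apply₂₂, Matrix.zero_apply, zero_mul,
    Finset.sum_const_zero, zero_add, Matrix.smul_apply, smul_eq_mul,
    pd_twistedMetric_inr_inr hh hf hfpos, pd_inr_comp_inr (hh.2.2 _ _)]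
  rw [← h1, ← h2]
  simp only [Finset.mul_sum, ← Finset.sum_add_distrib, ← Finset.sum_sub_distrib]
  refine Finset.sum_congr rfl fun δ _ => ?_
  field_simp
  ring

theorem sum_christoffel_inl (hg : IsMetric g) (hh : IsMetric h)
    (hf : ContDiff ℝ ∞ f) (hfpos : ∀ x, 0 < f x) (x : (Fin m ⊕ Fin n) → ℝ) (a : Fin m) :
    ∑ k, christoffel (twistedMetric g h f) k k (Sum.inl a) x
      = (∑ b, christoffel g b b a (x ∘ Sum.inl))
        + n * pd (Sum.inl a) (fun z => Real.log (f z)) x := by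
  simp [Fintype.sum_sum_type, christoffel_inl_inl_inl hg hh hfpos,
    christoffel_inr_inr_inl hg hh hf hfpos]

theorem sum_christoffel_inr (hg : IsMetric g) (hh : IsMetric h)
    (hf : ContDiff ℝ ∞ f) (hfpos : ∀ x, 0 < f x) (x : (Fin m ⊕ Fin n) → ℝ) (γ : Fin n) :
    ∑ k, christoffel (twistedMetric g h f) k k (Sum.inr γ) x
      = (∑ δ, christoffel h δ δ γ (x ∘ Sum.inr))
        + n * pd (Sum.inr γ) (fun z => Real.log (f z)) x := by
  have h1 : ∑ δ, h (x ∘ Sum.inr) δ γ * ∑ β, (h (x ∘ Sum.inr))⁻¹ δ β *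
      pd (Sum.inr β) (fun z => Real.log (f z)) x = pd (Sum.inr γ) (fun z => Real.log (f z)) x := by
    simp only [hh.symm_apply _ _ γ]
    exact hh.sum_mul_inv_mul (x ∘ Sum.inr) γ fun β => pd (Sum.inr β) (fun z => Real.log (f z)) x
  simp [Fintype.sum_sum_type, christoffel_inl_inl_inr hg hh hfpos,
    christoffel_inr_inr_inr hg hh hf hfpos, Finset.sum_add_distrib, Finset.sum_sub_distrib, h1]
  ring

theorem hess_inl_inl (hg : IsMetric g) (hh : IsMetric h) (hfpos : ∀ x, 0 < f x)
    (x : (Fin m ⊕ Fin n) → ℝ) (φ : (Fin m ⊕ Fin n → ℝ) → ℝ) (a b : Fin m) :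
    hess (twistedMetric g h f) φ (Sum.inl a) (Sum.inl b) x
      = pd (Sum.inl a) (pd (Sum.inl b) φ) x
        - ∑ c, christoffel g c a b (x ∘ Sum.inl) * pd (Sum.inl c) φ x := by
  simp [hess, christoffel_inl_inl_inl hg hh hfpos, christoffel_inr_inl_inl hg hh hfpos]

theorem gradInner_twistedMetric (hg : IsMetric g) (hh : IsMetric h) (hfpos : ∀ x, 0 < f x)
    (x : (Fin m ⊕ Fin n) → ℝ) (φ : (Fin m ⊕ Fin n → ℝ) → ℝ) :
    gradInner (twistedMetric g h f) φ φ x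
      = (∑ a, (∑ b, (g (x ∘ Sum.inl))⁻¹ a b * pd (Sum.inl b) φ x) * pd (Sum.inl a) φ x)
        + (f x ^ 2)⁻¹ * ∑ γ, (∑ δ, (h (x ∘ Sum.inr))⁻¹ γ δ * pd (Sum.inr δ) φ x)
            * pd (Sum.inr γ) φ x := by
  simp only [gradInner, Fintype.sum_sum_type, inv_twistedMetric hg hh hfpos,
    Matrix.fromBlocks_apply₁₁, Matrix.fromBlocks_apply₁₂, Matrix.fromBlocks_apply₂₁,
    Matrix.fromBlocks_apply₂₂, Matrix.zero_apply, zero_mul, Finset.sum_const_zero, zero_add,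
    add_zero, Matrix.smul_apply, smul_eq_mul, Finset.mul_sum, Finset.sum_mul]
  congr 1
  all_goals exact Finset.sum_congr rfl fun _ _ => Finset.sum_congr rfl fun _ _ => by ring

theorem hess_inr_inr (hg : IsMetric g) (hh : IsMetric h)
    (hf : ContDiff ℝ ∞ f) (hfpos : ∀ x, 0 < f x) (x : (Fin m ⊕ Fin n) → ℝ) (α β : Fin n) :
    hess (twistedMetric g h f) (fun z => Real.log (f z)) (Sum.inr α) (Sum.inr β) x
      = pd (Sum.inr α) (pd (Sum.inr β) (fun z => Real.log (f z))) x
        - (∑ γ, christoffel h γ α β (x ∘ Sum.inr) * pd (Sum.inr γ) (fun z => Real.log (f z)) x)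
        - 2 * pd (Sum.inr α) (fun z => Real.log (f z)) x
            * pd (Sum.inr β) (fun z => Real.log (f z)) x
        + twistedMetric g h f x (Sum.inr α) (Sum.inr β)
            * gradInner (twistedMetric g h f) (fun z => Real.log (f z))
                (fun z => Real.log (f z)) x := by
  have hF : f x ≠ 0 := (hfpos x).ne'
  have hT : twistedMetric g h f x (Sum.inr α) (Sum.inr β)
    = f x ^ 2 * h (x ∘ Sum.inr) α β := rfl
  have h1 (e w : Fin n → ℝ) (c : ℝ) : ∑ γ, c * w γ * e γ = c * ∑ γ, w γ * e γ := by
    simp only [Finset.mul_sum, mul_assoc]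
  have h2 (e w : Fin m → ℝ) (c : ℝ) : ∑ γ, c * w γ * e γ = c * ∑ γ, w γ * e γ := by
    simp only [Finset.mul_sum, mul_assoc]
  simp only [hess, Fintype.sum_sum_type, christoffel_inl_inr_inr hg hh hf hfpos,
    christoffel_inr_inr_inr hg hh hf hfpos, add_mul, sub_mul, Finset.sum_add_distrib,
    Finset.sum_sub_distrib, ite_mul, zero_mul, Finset.sum_ite_eq', Finset.mem_univ, if_true,
    neg_mul, Finset.sum_neg_distrib, hT, gradInner_twistedMetric hg hh hfpos, h1, h2]
  field_simp
  ring

theorem laplacian_twistedMetric (hg : IsMetric g) (hh : IsMetric h)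
    (hf : ContDiff ℝ ∞ f) (hfpos : ∀ x, 0 < f x) (x : (Fin m ⊕ Fin n) → ℝ) :
    laplacian (twistedMetric g h f) (fun z => Real.log (f z)) x
      = (∑ a, ∑ b, (g (x ∘ Sum.inl))⁻¹ a b *
          (pd (Sum.inl a) (pd (Sum.inl b) (fun z => Real.log (f z))) x
            - ∑ c, christoffel g c a b (x ∘ Sum.inl)
                * pd (Sum.inl c) (fun z => Real.log (f z)) x))
        + (f x ^ 2)⁻¹ * (∑ α, ∑ β, (h (x ∘ Sum.inr))⁻¹ α β *
          (pd (Sum.inr α) (pd (Sum.inr β) (fun z => Real.log (f z))) x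
            - ∑ γ, christoffel h γ α β (x ∘ Sum.inr)
                * pd (Sum.inr γ) (fun z => Real.log (f z)) x))
        - 2 * (f x ^ 2)⁻¹ * (∑ γ, (∑ δ, (h (x ∘ Sum.inr))⁻¹ γ δ *
            pd (Sum.inr δ) (fun z => Real.log (f z)) x) * pd (Sum.inr γ) (fun z => Real.log (f z)) x)
        + n * gradInner (twistedMetric g h f) (fun z => Real.log (f z))
                (fun z => Real.log (f z)) x := by
  have hF : f x ≠ 0 := (hfpos x).ne'
  have hn : ∑ α, ∑ β, (h (x ∘ Sum.inr))⁻¹ α β * h (x ∘ Sum.inr) α β = n := by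
    have (α : Fin n) : ∑ β, (h (x ∘ Sum.inr))⁻¹ α β * h (x ∘ Sum.inr) α β = 1 := by
      simp only [hh.symm_apply _ α, hh.sum_inv_mul, if_true]
    simp [this]
  rw [← hn]
  simp only [laplacian, Fintype.sum_sum_type, inv_twistedMetric hg hh hfpos,
    Matrix.fromBlocks_apply₁₁, Matrix.fromBlocks_apply₁₂, Matrix.fromBlocks_apply₂₁,
    Matrix.fromBlocks_apply₂₂, Matrix.zero_apply, zero_mul, Finset.sum_const_zero, zero_add,
    add_zero, Matrix.smul_apply, smul_eq_mul, hess_inl_inl hg hh hfpos,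
    hess_inr_inr hg hh hf hfpos, add_sub_assoc, add_assoc]
  congr 1
  generalize gradInner (twistedMetric g h f) (fun z => Real.log (f z))
                (fun z => Real.log (f z)) x = N
  have hT (α β : Fin n) : twistedMetric g h f x (Sum.inr α) (Sum.inr β)
    = f x ^ 2 * h (x ∘ Sum.inr) α β := rfl
  simp only [hT, Finset.mul_sum, Finset.sum_mul, ← Finset.sum_add_distrib,
    ← Finset.sum_sub_distrib]
  refine Finset.sum_congr rfl fun α _ => Finset.sum_congr rfl fun β _ => ?_
  field_simp

theorem pd_inl_sharp (hg : IsMetric g) (x : (Fin m ⊕ Fin n) → ℝ)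
    {φ : (Fin m ⊕ Fin n → ℝ) → ℝ} (hφ : ContDiff ℝ ∞ φ) (i a : Fin m) :
    pd (Sum.inl i) (fun y => ∑ b, (g (y ∘ Sum.inl))⁻¹ a b * pd (Sum.inl b) φ y) x
      = ∑ b, (pd i (fun z => (g z)⁻¹ a b) (x ∘ Sum.inl) * pd (Sum.inl b) φ x
          + (g (x ∘ Sum.inl))⁻¹ a b * pd (Sum.inl i) (pd (Sum.inl b) φ) x) := by
  have hd (b : Fin m) : DifferentiableAt ℝ (fun y : Fin m ⊕ Fin n → ℝ =>
      (g (y ∘ Sum.inl))⁻¹ a b) x :=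
    (contDiff_comp_right Sum.inl (hg.contDiff_inv a b)).differentiable (by simp) x
  have hd' (b : Fin m) : DifferentiableAt ℝ (pd (Sum.inl b) φ) x :=
    (contDiff_pd (Sum.inl b) hφ).differentiable (by simp) x
  rw [pd_sum _ _ fun b _ => (hd b).fun_mul (hd' b)]
  refine Finset.sum_congr rfl fun b _ => ?_
  rw [pd_mul _ (hd b) (hd' b), pd_inl_comp_inl (hg.contDiff_inv a b)]

theorem pd_inr_sharp (hh : IsMetric h) (x : (Fin m ⊕ Fin n) → ℝ)
    {φ : (Fin m ⊕ Fin n → ℝ) → ℝ} (hφ : ContDiff ℝ ∞ φ) (i α : Fin n) :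
    pd (Sum.inr i) (fun y => ∑ δ, (h (y ∘ Sum.inr))⁻¹ α δ * pd (Sum.inr δ) φ y) x
      = ∑ δ, (pd i (fun z => (h z)⁻¹ α δ) (x ∘ Sum.inr) * pd (Sum.inr δ) φ x
          + (h (x ∘ Sum.inr))⁻¹ α δ * pd (Sum.inr i) (pd (Sum.inr δ) φ) x) := by
  have hd (b : Fin n) : DifferentiableAt ℝ (fun y : Fin m ⊕ Fin n → ℝ =>
      (h (y ∘ Sum.inr))⁻¹ α b) x :=
    (contDiff_comp_right Sum.inr (hh.contDiff_inv α b)).differentiable (by simp) x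
  have hd' (b : Fin n) : DifferentiableAt ℝ (pd (Sum.inr b) φ) x :=
    (contDiff_pd (Sum.inr b) hφ).differentiable (by simp) x
  rw [pd_sum _ _ fun b _ => (hd b).fun_mul (hd' b)]
  refine Finset.sum_congr rfl fun b _ => ?_
  rw [pd_mul _ (hd b) (hd' b), pd_inr_comp_inr (hh.contDiff_inv α b)]

theorem contDiff_sharp_inl (hg : IsMetric g)
    {φ : (Fin m ⊕ Fin n → ℝ) → ℝ} (hφ : ContDiff ℝ ∞ φ) (a : Fin m) :
    ContDiff ℝ ∞ (fun y => ∑ b, (g (y ∘ Sum.inl))⁻¹ a b * pd (Sum.inl b) φ y) :=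
  ContDiff.sum fun b _ => (contDiff_comp_right Sum.inl (hg.contDiff_inv a b)).mul (contDiff_pd _ hφ)

theorem contDiff_sharp_inr (hh : IsMetric h)
    {φ : (Fin m ⊕ Fin n → ℝ) → ℝ} (hφ : ContDiff ℝ ∞ φ) (α : Fin n) :
    ContDiff ℝ ∞ (fun y => ∑ δ, (h (y ∘ Sum.inr))⁻¹ α δ * pd (Sum.inr δ) φ y) :=
  ContDiff.sum fun δ _ => (contDiff_comp_right Sum.inr (hh.contDiff_inv α δ)).mul (contDiff_pd _ hφ)

theorem sum_pd_christoffel_inl (hg : IsMetric g) (hh : IsMetric h)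
    (hf : ContDiff ℝ ∞ f) (hfpos : ∀ x, 0 < f x) (x : (Fin m ⊕ Fin n) → ℝ) (α β : Fin n) :
    ∑ a, pd (Sum.inl a) (christoffel (twistedMetric g h f) (Sum.inl a) (Sum.inr α) (Sum.inr β)) x
      = -(f x ^ 2 * h (x ∘ Sum.inr) α β *
        (2 * (∑ a, (∑ b, (g (x ∘ Sum.inl))⁻¹ a b * pd (Sum.inl b) (fun z => Real.log (f z)) x)
            * pd (Sum.inl a) (fun z => Real.log (f z)) x)
          + ∑ a, ∑ b, (pd a (fun z => (g z)⁻¹ a b) (x ∘ Sum.inl)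
                * pd (Sum.inl b) (fun z => Real.log (f z)) x
              + (g (x ∘ Sum.inl))⁻¹ a b
                * pd (Sum.inl a) (pd (Sum.inl b) (fun z => Real.log (f z))) x))) := by
  have hξ : ContDiff ℝ ∞ (fun z => Real.log (f z)) := hf.log fun z => (hfpos z).ne'
  have hF : DifferentiableAt ℝ (fun y => f y ^ 2) x := (hf.pow 2).differentiable (by simp) x
  have hH : DifferentiableAt ℝ (fun y : Fin m ⊕ Fin n → ℝ => h (y ∘ Sum.inr) α β) x :=
    (contDiff_comp_right Sum.inr (hh.2.2 α β)).differentiable (by simp) x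
  rw [Finset.mul_sum, ← Finset.sum_add_distrib, Finset.mul_sum, ← Finset.sum_neg_distrib]
  refine Finset.sum_congr rfl fun a _ => ?_
  rw [funext fun y => christoffel_inl_inr_inr hg hh hf hfpos y a α β, pd_neg,
    pd_mul _ (hF.fun_mul hH) ((contDiff_sharp_inl hg hξ a).differentiable (by simp) x),
    pd_mul _ hF hH, pd_sq_eq_log hf hfpos, pd_inl_comp_inr (hh.2.2 α β), pd_inl_sharp hg x hξ]
  ring

theorem sum_pd_christoffel_inr (hg : IsMetric g) (hh : IsMetric h)
    (hf : ContDiff ℝ ∞ f) (hfpos : ∀ x, 0 < f x) (x : (Fin m ⊕ Fin n) → ℝ) (α β : Fin n) :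
    ∑ γ, pd (Sum.inr γ) (christoffel (twistedMetric g h f) (Sum.inr γ) (Sum.inr α) (Sum.inr β)) x
      = (∑ γ, pd γ (christoffel h γ α β) (x ∘ Sum.inr))
        + 2 * pd (Sum.inr α) (pd (Sum.inr β) (fun z => Real.log (f z))) x
        - (∑ γ, pd γ (fun z => h z α β) (x ∘ Sum.inr) *
            ∑ δ, (h (x ∘ Sum.inr))⁻¹ γ δ * pd (Sum.inr δ) (fun z => Real.log (f z)) x)
        - h (x ∘ Sum.inr) α β *
          ∑ γ, ∑ δ, (pd γ (fun z => (h z)⁻¹ γ δ) (x ∘ Sum.inr)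
                * pd (Sum.inr δ) (fun z => Real.log (f z)) x
              + (h (x ∘ Sum.inr))⁻¹ γ δ
                * pd (Sum.inr γ) (pd (Sum.inr δ) (fun z => Real.log (f z))) x) := by
  have hξ : ContDiff ℝ ∞ (fun z => Real.log (f z)) := hf.log fun z => (hfpos z).ne'
  have hH : DifferentiableAt ℝ (fun y : Fin m ⊕ Fin n → ℝ => h (y ∘ Sum.inr) α β) x :=
    (contDiff_comp_right Sum.inr (hh.2.2 α β)).differentiable (by simp) x
  have hite (γ δ ε : Fin n) : ContDiff ℝ ∞ (fun y => if γ = δ then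
      pd (Sum.inr ε) (fun z => Real.log (f z)) y else 0) := by
    split_ifs
    · exact contDiff_pd _ hξ
    · exact contDiff_const
  have hpd (γ δ ε : Fin n) : pd (Sum.inr γ) (fun y => if γ = δ then
      pd (Sum.inr ε) (fun z => Real.log (f z)) y else 0) x = if γ = δ then
      pd (Sum.inr γ) (pd (Sum.inr ε) (fun z => Real.log (f z))) x else 0 := by
    split_ifs
    · rfl
    · exact pd_const _ _ _
  have hΓ (γ : Fin n) : ContDiff ℝ ∞ (fun y : Fin m ⊕ Fin n → ℝ =>
      christoffel h γ α β (y ∘ Sum.inr)) := contDiff_comp_right _ (hh.contDiff_christoffel γ α β)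
  have hS (γ : Fin n) := contDiff_sharp_inr hh hξ γ
  have key (γ : Fin n) : pd (Sum.inr γ)
      (christoffel (twistedMetric g h f) (Sum.inr γ) (Sum.inr α) (Sum.inr β)) x
      = pd γ (christoffel h γ α β) (x ∘ Sum.inr)
        + (if γ = β then pd (Sum.inr γ) (pd (Sum.inr α) (fun z => Real.log (f z))) x else 0)
        + (if γ = α then pd (Sum.inr γ) (pd (Sum.inr β) (fun z => Real.log (f z))) x else 0)
        - (pd γ (fun z => h z α β) (x ∘ Sum.inr) *
            (∑ δ, (h (x ∘ Sum.inr))⁻¹ γ δ * pd (Sum.inr δ) (fun z => Real.log (f z)) x)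
          + h (x ∘ Sum.inr) α β *
          ∑ δ, (pd γ (fun z => (h z)⁻¹ γ δ) (x ∘ Sum.inr)
                * pd (Sum.inr δ) (fun z => Real.log (f z)) x
              + (h (x ∘ Sum.inr))⁻¹ γ δ
                * pd (Sum.inr γ) (pd (Sum.inr δ) (fun z => Real.log (f z))) x)) := by
    rw [funext fun y => christoffel_inr_inr_inr hg hh hf hfpos y γ α β,
      pd_sub _ ((((hΓ γ).add (hite γ β α)).add (hite γ α β)).differentiable (by simp) x)
        (hH.fun_mul ((hS γ).differentiable (by simp) x)),
      pd_add _ (((hΓ γ).add (hite γ β α)).differentiable (by simp) x)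
        ((hite γ α β).differentiable (by simp) x),
      pd_add _ ((hΓ γ).differentiable (by simp) x) ((hite γ β α).differentiable (by simp) x),
      pd_mul _ hH ((hS γ).differentiable (by simp) x), hpd, hpd,
      pd_inr_comp_inr (hh.contDiff_christoffel γ α β), pd_inr_comp_inr (hh.2.2 α β),
      pd_inr_sharp hh x hξ]
  simp only [key, Finset.sum_add_distrib, Finset.sum_sub_distrib, Finset.sum_ite_eq',
    Finset.mem_univ, if_true, ← Finset.mul_sum, pd_comm (Sum.inr β) (Sum.inr α) hξ]
  ring

theorem sum_pd_christoffel_trace (hg : IsMetric g) (hh : IsMetric h)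
    (hf : ContDiff ℝ ∞ f) (hfpos : ∀ x, 0 < f x) (x : (Fin m ⊕ Fin n) → ℝ) (α β : Fin n) :
    ∑ k, pd (Sum.inr β) (christoffel (twistedMetric g h f) k (Sum.inr α) k) x
      = (∑ γ, pd β (christoffel h γ α γ) (x ∘ Sum.inr))
        + n * pd (Sum.inr α) (pd (Sum.inr β) (fun z => Real.log (f z))) x := by
  have hξ : ContDiff ℝ ∞ (fun z => Real.log (f z)) := hf.log fun z => (hfpos z).ne'
  have hT := hg.twistedMetric hh hf hfpos
  have hΓ (γ : Fin n) : ContDiff ℝ ∞ (fun y : Fin m ⊕ Fin n → ℝ =>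
      christoffel h γ α γ (y ∘ Sum.inr)) := contDiff_comp_right _ (hh.contDiff_christoffel γ α γ)
  have h1 : (fun y => ∑ k, christoffel (twistedMetric g h f) k (Sum.inr α) k y)
      = fun y => (∑ γ, christoffel h γ α γ (y ∘ Sum.inr))
        + n * pd (Sum.inr α) (fun z => Real.log (f z)) y := by
    funext y
    simp only [hT.christoffel_symm _ (Sum.inr α), hh.christoffel_symm _ α]
    exact sum_christoffel_inr hg hh hf hfpos y α
  rw [← pd_sum _ _ fun k _ => (hT.contDiff_christoffel k (Sum.inr α) k).differentiable (by simp) x,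
    h1, pd_add _ ((ContDiff.sum fun γ _ => hΓ γ).differentiable (by simp) x)
      ((contDiff_const.mul (contDiff_pd _ hξ)).differentiable (by simp) x),
    pd_sum _ _ fun γ _ => (hΓ γ).differentiable (by simp) x,
    pd_mul _ (differentiableAt_const _) ((contDiff_pd _ hξ).differentiable (by simp) x),
    pd_comm (Sum.inr α) (Sum.inr β) hξ]
  simp [fun γ => pd_inr_comp_inr (κ := Fin m) (hh.contDiff_christoffel γ α γ) β x]

theorem sum_trace_mul_christoffel (hg : IsMetric g) (hh : IsMetric h)
    (hf : ContDiff ℝ ∞ f) (hfpos : ∀ x, 0 < f x) (x : (Fin m ⊕ Fin n) → ℝ) (α β : Fin n) :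
    ∑ l, (∑ k, christoffel (twistedMetric g h f) k k l x)
        * christoffel (twistedMetric g h f) l (Sum.inr α) (Sum.inr β) x
      = (∑ γ, (∑ δ, christoffel h δ δ γ (x ∘ Sum.inr)) * christoffel h γ α β (x ∘ Sum.inr))
        + n * (∑ γ, christoffel h γ α β (x ∘ Sum.inr) * pd (Sum.inr γ) (fun z => Real.log (f z)) x)
        + (∑ δ, christoffel h δ δ α (x ∘ Sum.inr)) * pd (Sum.inr β) (fun z => Real.log (f z)) x
        + (∑ δ, christoffel h δ δ β (x ∘ Sum.inr)) * pd (Sum.inr α) (fun z => Real.log (f z)) x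
        + 2 * n * pd (Sum.inr α) (fun z => Real.log (f z)) x
          * pd (Sum.inr β) (fun z => Real.log (f z)) x
        - h (x ∘ Sum.inr) α β * (∑ γ, (∑ δ, christoffel h δ δ γ (x ∘ Sum.inr)) *
            ∑ δ, (h (x ∘ Sum.inr))⁻¹ γ δ * pd (Sum.inr δ) (fun z => Real.log (f z)) x)
        - f x ^ 2 * h (x ∘ Sum.inr) α β * (∑ a, (∑ k, christoffel g k k a (x ∘ Sum.inl)) *
            ∑ b, (g (x ∘ Sum.inl))⁻¹ a b * pd (Sum.inl b) (fun z => Real.log (f z)) x)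
        - n * twistedMetric g h f x (Sum.inr α) (Sum.inr β)
            * gradInner (twistedMetric g h f) (fun z => Real.log (f z))
                (fun z => Real.log (f z)) x := by
  have hF : f x ≠ 0 := (hfpos x).ne'
  have hT : twistedMetric g h f x (Sum.inr α) (Sum.inr β)
    = f x ^ 2 * h (x ∘ Sum.inr) α β := rfl
  rw [gradInner_twistedMetric hg hh hfpos, hT, Fintype.sum_sum_type]
  simp only [sum_christoffel_inl hg hh hf hfpos, sum_christoffel_inr hg hh hf hfpos,
    christoffel_inl_inr_inr hg hh hf hfpos, christoffel_inr_inr_inr hg hh hf hfpos]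
  generalize hu : (fun a => ∑ b, (g (x ∘ Sum.inl))⁻¹ a b *
    pd (Sum.inl b) (fun z => Real.log (f z)) x) = u
  generalize hv : (fun a => ∑ b, (h (x ∘ Sum.inr))⁻¹ a b *
    pd (Sum.inr b) (fun z => Real.log (f z)) x) = v
  have hu' (a : Fin m) : ∑ b, (g (x ∘ Sum.inl))⁻¹ a b *
    pd (Sum.inl b) (fun z => Real.log (f z)) x = u a := congrFun hu a
  have hv' (a : Fin n) : ∑ b, (h (x ∘ Sum.inr))⁻¹ a b *
    pd (Sum.inr b) (fun z => Real.log (f z)) x = v a := congrFun hv a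
  simp only [hu', hv']
  have h1 : ∑ a, ((∑ b, christoffel g b b a (x ∘ Sum.inl))
        + n * pd (Sum.inl a) (fun z => Real.log (f z)) x)
          * -(f x ^ 2 * h (x ∘ Sum.inr) α β * u a)
      = -(f x ^ 2 * h (x ∘ Sum.inr) α β) *
        ((∑ a, (∑ b, christoffel g b b a (x ∘ Sum.inl)) * u a)
          + n * ∑ a, u a * pd (Sum.inl a) (fun z => Real.log (f z)) x) := by
    rw [Finset.mul_sum _ _ (n : ℝ), ← Finset.sum_add_distrib, Finset.mul_sum]
    exact Finset.sum_congr rfl fun a _ => by ring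
  have h2 (t : Fin n → ℝ) : ∑ γ, t γ * (h (x ∘ Sum.inr) α β * v γ)
      = h (x ∘ Sum.inr) α β * ∑ γ, t γ * v γ := by
    rw [Finset.mul_sum]
    exact Finset.sum_congr rfl fun a _ => by ring
  have h3 (t s : Fin n → ℝ) : ∑ γ, n * t γ * s γ = n * ∑ γ, s γ * t γ := by
    rw [Finset.mul_sum]
    exact Finset.sum_congr rfl fun a _ => by ring
  rw [h1]
  simp only [mul_add, mul_sub, Finset.sum_add_distrib, Finset.sum_sub_distrib, h2, mul_ite,
    mul_zero, Finset.sum_ite_eq', Finset.mem_univ, if_true, add_mul, h3]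
  field_simp
  ring

theorem sum_christoffel_mul_christoffel (hg : IsMetric g) (hh : IsMetric h)
    (hf : ContDiff ℝ ∞ f) (hfpos : ∀ x, 0 < f x) (x : (Fin m ⊕ Fin n) → ℝ) (α β : Fin n) :
    ∑ k, ∑ l, christoffel (twistedMetric g h f) k (Sum.inr β) l x
        * christoffel (twistedMetric g h f) l (Sum.inr α) k x
      = (∑ γ, ∑ δ, christoffel (twistedMetric g h f) (Sum.inr γ) (Sum.inr β) (Sum.inr δ) x
          * christoffel (twistedMetric g h f) (Sum.inr δ) (Sum.inr α) (Sum.inr γ) x)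
        - 2 * f x ^ 2 * h (x ∘ Sum.inr) α β *
          ∑ a, (∑ b, (g (x ∘ Sum.inl))⁻¹ a b * pd (Sum.inl b) (fun z => Real.log (f z)) x)
            * pd (Sum.inl a) (fun z => Real.log (f z)) x := by
  simp only [Fintype.sum_sum_type, christoffel_inl_inr_inl hg hh hfpos,
    christoffel_inl_inr_inr hg hh hf hfpos, christoffel_inr_inr_inl hg hh hf hfpos,
    mul_zero, Finset.sum_const_zero, zero_add, Finset.sum_add_distrib, mul_ite, ite_mul, zero_mul,
    Finset.sum_ite_eq', Finset.mem_univ, if_true, hh.symm_apply _ β α]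
  rw [Finset.sum_comm]
  simp only [Finset.sum_ite_eq', Finset.mem_univ, if_true]
  have h1 : ∑ a, -(f x ^ 2 * h (x ∘ Sum.inr) α β * ∑ b, (g (x ∘ Sum.inl))⁻¹ a b *
      pd (Sum.inl b) (fun z => Real.log (f z)) x) * pd (Sum.inl a) (fun z => Real.log (f z)) x
      = -(f x ^ 2 * h (x ∘ Sum.inr) α β) * ∑ a, (∑ b, (g (x ∘ Sum.inl))⁻¹ a b *
      pd (Sum.inl b) (fun z => Real.log (f z)) x) * pd (Sum.inl a) (fun z => Real.log (f z)) x := by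
    rw [Finset.mul_sum]
    exact Finset.sum_congr rfl fun a _ => by ring
  have h2 (a : Fin m) (c : ℝ) : pd (Sum.inl a) (fun z => Real.log (f z)) x * -c
      = -c * pd (Sum.inl a) (fun z => Real.log (f z)) x := mul_comm _ _
  simp only [h2, h1]
  ring

theorem sum_conformal_mul_conformal {κ : Type*} [Fintype κ] [DecidableEq κ] (Γ : κ → κ → κ → ℝ)
    (H : κ → κ → ℝ) (e v : κ → ℝ) (hΓ : ∀ i j k, Γ i j k = Γ i k j) (hH : ∀ i j, H i j = H j i)
    (hv : ∀ i, ∑ j, H i j * v j = e i) (α β : κ) :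
    ∑ k, ∑ l, (Γ k β l + (if k = l then e β else 0) + (if k = β then e l else 0) - H β l * v k)
        * (Γ l α k + (if l = k then e α else 0) + (if l = α then e k else 0) - H α k * v l)
      = (∑ k, ∑ l, Γ k β l * Γ l α k) + 2 * (∑ k, Γ k α β * e k)
        + (∑ k, Γ k k β) * e α + (∑ k, Γ k k α) * e β
        - (∑ k, ∑ l, (Γ k β l * H α k + Γ k α l * H β k) * v l)
        + (Fintype.card κ + 2) * e α * e β - 2 * H α β * ∑ k, v k * e k := by
  simp only [mul_add, add_mul, mul_sub, sub_mul, Finset.sum_add_distrib, Finset.sum_sub_distrib,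
    ite_mul, mul_ite, zero_mul, mul_zero, Finset.sum_ite_eq, Finset.sum_ite_eq', Finset.mem_univ,
    if_true, Finset.sum_ite_irrel, Finset.sum_const_zero]
  have h1 (c d : κ) : ∑ k, e c * Γ k d k = (∑ k, Γ k k d) * e c := by
    rw [Finset.sum_mul]
    exact Finset.sum_congr rfl fun k _ => by rw [hΓ k d k, mul_comm]
  have h2 : ∑ k, Γ k β k * e α = (∑ k, Γ k k β) * e α := by
    rw [Finset.sum_mul]
    exact Finset.sum_congr rfl fun k _ => by rw [hΓ k β k]
  have h3 : ∑ k, e k * Γ k α β = ∑ k, Γ k α β * e k :=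
    Finset.sum_congr rfl fun k _ => mul_comm _ _
  have h4 : ∑ k, Γ k β α * e k = ∑ k, Γ k α β * e k :=
    Finset.sum_congr rfl fun k _ => by rw [hΓ]
  have h5 : ∑ k, ∑ l, H β l * v k * Γ l α k = ∑ k, ∑ l, Γ k α l * H β k * v l := by
    rw [Finset.sum_comm]
    exact Finset.sum_congr rfl fun k _ => Finset.sum_congr rfl fun l _ => by ring
  have h6 : ∑ k, ∑ l, Γ k β l * (H α k * v l) = ∑ k, ∑ l, Γ k β l * H α k * v l := by
    simp only [mul_assoc]
  have h7 (c : κ) : ∑ k, e c * (H α k * v k) = e c * e α := by rw [← Finset.mul_sum, hv]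
  have h8 : ∑ k, H β k * v k * e α = e β * e α := by rw [← Finset.sum_mul, hv]
  have h9 : ∑ k, H β α * v k * e k = H α β * ∑ k, v k * e k := by
    rw [Finset.mul_sum, hH β α]
    exact Finset.sum_congr rfl fun k _ => by ring
  have h10 : ∑ k, e k * (H α β * v k) = H α β * ∑ k, v k * e k := by
    rw [Finset.mul_sum]
    exact Finset.sum_congr rfl fun k _ => by ring
  have h11 : ∑ k, ∑ l, H β l * v k * (H α k * v l) = e α * e β := by
    rw [← hv α, ← hv β, Finset.sum_mul_sum]
    exact Finset.sum_congr rfl fun k _ => Finset.sum_congr rfl fun l _ => by ring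
  rw [h1, h2, h3, h4, h5, h6, h7, h8, h9, h10, h11]
  simp only [Finset.sum_const, Finset.card_univ, nsmul_eq_mul]
  ring

end Twisted

/-- fiber Ricci components of a twisted product, with `ξ = log f` and
Hessian, gradient and Laplacian taken with respect to `ḡ`. -/
theorem twisted_fiber_ricci {m n : ℕ}
    (g : (Fin m → ℝ) → Matrix (Fin m) (Fin m) ℝ)
    (h : (Fin n → ℝ) → Matrix (Fin n) (Fin n) ℝ)
    (f : ((Fin m ⊕ Fin n) → ℝ) → ℝ)
    (hg : IsMetric g) (hh : IsMetric h)
    (hf : ContDiff ℝ (⊤ : ℕ∞) f) (hfpos : ∀ x, 0 < f x) :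
    ∀ (x : (Fin m ⊕ Fin n) → ℝ) (α β : Fin n),
      ricci (twistedMetric g h f) (Sum.inr α) (Sum.inr β) x
        = ricci h α β (x ∘ Sum.inr)
          + (2 - (n : ℝ)) *
            (pd (Sum.inr α) (fun z => Real.log (f z)) x
                * pd (Sum.inr β) (fun z => Real.log (f z)) x
              + hess (twistedMetric g h f) (fun z => Real.log (f z))
                  (Sum.inr α) (Sum.inr β) x)
          + ((n : ℝ) - 2) * twistedMetric g h f x (Sum.inr α) (Sum.inr β)
              * gradInner (twistedMetric g h f) (fun z => Real.log (f z))
                  (fun z => Real.log (f z)) x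
          - twistedMetric g h f x (Sum.inr α) (Sum.inr β)
              * laplacian (twistedMetric g h f) (fun z => Real.log (f z)) x := by
  intro x α β
  have hT := hg.twistedMetric hh hf hfpos
  have hF : f x ≠ 0 := (hfpos x).ne'
  have hGG : twistedMetric g h f x (Sum.inr α) (Sum.inr β)
    = f x ^ 2 * h (x ∘ Sum.inr) α β := rfl
  have hdg := hg.divergence_eq (x ∘ Sum.inl) (fun a => pd (Sum.inl a) (fun z => Real.log (f z)) x)
    (fun a b => pd (Sum.inl a) (pd (Sum.inl b) (fun z => Real.log (f z))) x)
  have hdh := hh.divergence_eq (x ∘ Sum.inr) (fun a => pd (Sum.inr a) (fun z => Real.log (f z)) x)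
    (fun a b => pd (Sum.inr a) (pd (Sum.inr b) (fun z => Real.log (f z))) x)
  have hCC := sum_conformal_mul_conformal
    (fun i j k => christoffel h i j k (x ∘ Sum.inr)) (h (x ∘ Sum.inr))
    (fun a => pd (Sum.inr a) (fun z => Real.log (f z)) x)
    (fun γ => ∑ δ, (h (x ∘ Sum.inr))⁻¹ γ δ * pd (Sum.inr δ) (fun z => Real.log (f z)) x)
    (fun i j k => hh.christoffel_symm i j k _) (hh.symm_apply _)
    (fun i => hh.sum_mul_inv_mul _ i _) α β
  have hZ : ∑ k, ∑ l, (christoffel h k β l (x ∘ Sum.inr) * h (x ∘ Sum.inr) α k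
        + christoffel h k α l (x ∘ Sum.inr) * h (x ∘ Sum.inr) β k) *
          (∑ δ, (h (x ∘ Sum.inr))⁻¹ l δ * pd (Sum.inr δ) (fun z => Real.log (f z)) x)
      = ∑ γ, pd γ (fun z => h z α β) (x ∘ Sum.inr) *
            ∑ δ, (h (x ∘ Sum.inr))⁻¹ γ δ * pd (Sum.inr δ) (fun z => Real.log (f z)) x := by
    rw [Finset.sum_comm]
    refine Finset.sum_congr rfl fun γ _ => ?_
    rw [hh.pd_apply, Finset.sum_mul]
    refine Finset.sum_congr rfl fun l _ => ?_
    rw [hh.christoffel_symm l γ, hh.christoffel_symm l γ]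
    ring
  have hQ : ∑ k, ∑ l, christoffel (twistedMetric g h f) k k l x
        * christoffel (twistedMetric g h f) l (Sum.inr α) (Sum.inr β) x
      = ∑ l, (∑ k, christoffel (twistedMetric g h f) k k l x)
        * christoffel (twistedMetric g h f) l (Sum.inr α) (Sum.inr β) x := by
    rw [Finset.sum_comm]
    simp only [Finset.sum_mul]
  have hQh : ∑ k, ∑ l, christoffel h k k l (x ∘ Sum.inr) * christoffel h l α β (x ∘ Sum.inr)
      = ∑ l, (∑ k, christoffel h k k l (x ∘ Sum.inr)) * christoffel h l α β (x ∘ Sum.inr) := by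
    rw [Finset.sum_comm]
    simp only [Finset.sum_mul]
  rw [hZ] at hCC
  simp only [ricci, Finset.sum_sub_distrib, hQ, hQh, sum_pd_christoffel_trace hg hh hf hfpos,
    sum_trace_mul_christoffel hg hh hf hfpos]
  rw [Fintype.sum_sum_type, sum_pd_christoffel_inl hg hh hf hfpos,
    sum_pd_christoffel_inr hg hh hf hfpos, sum_christoffel_mul_christoffel hg hh hf hfpos,
    hess_inr_inr hg hh hf hfpos, laplacian_twistedMetric hg hh hf hfpos, ← hdg, ← hdh,
    gradInner_twistedMetric hg hh hfpos, hGG]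
  simp only [christoffel_inr_inr_inr hg hh hf hfpos]
  rw [hCC, Fintype.card_fin]
  field_simp
  ring
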